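/- arXiv:0905.3705 — 2 statements merged into one kernel-verified Lean document; each statement's English description precedes it below -/
import Mathlib

section
/- Let F and G be smooth cubics in ℂ[X,Y,Z] whose common projective zero set consists of exactly nine distinct points p₁,…,p₉ of ℙ², with F and G meeting transversally at each of these points. If H is a cubic that vanishes at eight of the nine points p₁,…,p₉, then H lies in the pencil spanned by F and G, i.e. there exist α, β ∈ ℂ with H = αF + βG. -/
open MvPolynomial

/-- The gradient of a polynomial in `ℂ[X,Y,Z]` at a point of `ℂ³`. -/
noncomputable def grad (F : MvPolynomial (Fin 3) ℂ) (v : Fin 3 → ℂ) : Fin 3 → ℂ :=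
  fun i => eval v (pderiv i F)

/-- A cubic: a nonzero homogeneous polynomial of degree 3 in `ℂ[X,Y,Z]`. -/
def IsCubic (F : MvPolynomial (Fin 3) ℂ) : Prop :=
  F ≠ 0 ∧ F.IsHomogeneous 3

/-- A smooth cubic: `(0,0,0)` is the only common zero in `ℂ³` of the three
partial derivatives. -/
def SmoothCubic (F : MvPolynomial (Fin 3) ℂ) : Prop :=
  IsCubic F ∧ ∀ v : Fin 3 → ℂ, grad F v = 0 → v = 0

/-- `F` and `G` meet transversally at (the projective point represented by) `v`:
their gradients at `v` are linearly independent over `ℂ`. -/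
def Transverse (F G : MvPolynomial (Fin 3) ℂ) (v : Fin 3 → ℂ) : Prop :=
  LinearIndependent ℂ ![grad F v, grad G v]

/-- Two nonzero vectors of `ℂ³` represent the same point of `ℙ²`. -/
def SameProjPt (u v : Fin 3 → ℂ) : Prop :=
  ∃ c : ℂ, c ≠ 0 ∧ c • u = v

/-- The common projective zero set of `F` and `G` consists of exactly the nine
distinct points of `ℙ²` represented by `p 0, …, p 8`. -/
def NinePoints (F G : MvPolynomial (Fin 3) ℂ) (p : Fin 9 → Fin 3 → ℂ) : Prop :=
  (∀ i, p i ≠ 0) ∧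
  (∀ i j, i ≠ j → ¬ SameProjPt (p i) (p j)) ∧
  (∀ i, eval (p i) F = 0 ∧ eval (p i) G = 0) ∧
  (∀ v : Fin 3 → ℂ, v ≠ 0 → eval v F = 0 → eval v G = 0 → ∃ i, SameProjPt (p i) v)

open Finset in
/-- The dimension of the space of ternary forms of degree `n`. -/
lemma finrank_homogeneousSubmodule_fin_three (n : ℕ) :
    Module.finrank ℂ (homogeneousSubmodule (Fin 3) ℂ n) = (n + 2).choose n := by
  classical
  have hset : {d : Fin 3 →₀ ℕ | d.degree = n} =
      ((univ : Finset (Fin 3)).finsuppAntidiag n : Set _) := by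
    ext d
    simp [Finsupp.degree_eq_sum]
  rw [homogeneousSubmodule_eq_finsupp_supported, hset]
  have h := Module.finrank_eq_card_basis
    (basisRestrictSupport ℂ ((univ : Finset (Fin 3)).finsuppAntidiag n : Set (Fin 3 →₀ ℕ)))
  have hcard := card_finsuppAntidiag_nat_eq_choose (s := (univ : Finset (Fin 3))) n
  rw [card_univ, Fintype.card_fin, show 3 + n - 1 = n + 2 by omega] at hcard
  rw [← hcard, ← Fintype.card_coe]
  exact h

instance finiteDimensional_homogeneousSubmodule (n : ℕ) :
    FiniteDimensional ℂ (homogeneousSubmodule (Fin 3) ℂ n) :=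
  Module.Finite.iff_fg.2 (homogeneousSubmodule_fg (Fin 3) ℂ n)

/-- The linear form with coefficient vector `u`. -/
noncomputable def linForm (u : Fin 3 → ℂ) : MvPolynomial (Fin 3) ℂ :=
  ∑ i, u i • X i

@[simp]
lemma eval_linForm (u v : Fin 3 → ℂ) : eval v (linForm u) = u ⬝ᵥ v := by
  simp [linForm, dotProduct, smul_eval]

lemma isHomogeneous_linForm (u : Fin 3 → ℂ) : (linForm u).IsHomogeneous 1 :=
  (homogeneousSubmodule (Fin 3) ℂ 1).sum_mem fun i _ =>
    (homogeneousSubmodule (Fin 3) ℂ 1).smul_mem _ (isHomogeneous_X ℂ i)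

lemma linForm_ne_zero {u : Fin 3 → ℂ} (hu : u ≠ 0) : linForm u ≠ 0 := fun h =>
  hu <| dotProduct_eq_zero u fun v => by rw [← eval_linForm, h, map_zero]

lemma MvPolynomial.IsHomogeneous.exists_eq_linForm {A : MvPolynomial (Fin 3) ℂ}
    (hA : A.IsHomogeneous 1) : ∃ u, A = linForm u := by
  have h : A ∈ homogeneousSubmodule (Fin 3) ℂ 1 := hA
  rw [homogeneousSubmodule_one_eq_span_X, Submodule.mem_span_range_iff_exists_fun] at h
  obtain ⟨u, hu⟩ := h
  exact ⟨u, hu.symm⟩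

lemma MvPolynomial.IsHomogeneous.eval_smul_eq {B : MvPolynomial (Fin 3) ℂ} {n : ℕ}
    (hB : B.IsHomogeneous n) (c : ℂ) (v : Fin 3 → ℂ) :
    eval (c • v) B = c ^ n * eval v B := by
  rw [eval_eq, eval_eq, Finset.mul_sum]
  refine Finset.sum_congr rfl fun d hd => ?_
  simp only [Pi.smul_apply, smul_eq_mul, mul_pow, Finset.prod_mul_distrib]
  rw [Finset.prod_pow_eq_pow_sum, hB.degree_eq_sum_deg_support hd]
  ring

lemma eval_restrict_line (B : MvPolynomial (Fin 3) ℂ) (a b : Fin 3 → ℂ) (t : ℂ) :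
    (aeval (fun i => Polynomial.C (a i) + Polynomial.C (b i) * Polynomial.X) B).eval t =
      eval (a + t • b) B := by
  induction B using MvPolynomial.induction_on with
  | C c => simp
  | add p q hp hq => simp only [map_add, Polynomial.eval_add, hp, hq]
  | mul_X p i h => simp [h, mul_comm t]

/-- A form of positive degree has a nontrivial zero on every line of the projective plane. -/
lemma MvPolynomial.IsHomogeneous.exists_zero_on_line {B : MvPolynomial (Fin 3) ℂ} {n : ℕ}
    (hB : B.IsHomogeneous n) (hn : n ≠ 0) {a b : Fin 3 → ℂ}
    (hab : LinearIndependent ℂ ![a, b]) :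
    ∃ s t : ℂ, s • a + t • b ≠ 0 ∧ eval (s • a + t • b) B = 0 := by
  rw [LinearIndependent.pair_iff] at hab
  set g := MvPolynomial.aeval (fun i => Polynomial.C (a i) + Polynomial.C (b i) * Polynomial.X) B
    with hg
  set f := MvPolynomial.aeval (fun i => Polynomial.C (b i) + Polynomial.C (a i) * Polynomial.X) B
    with hf
  by_cases hroot : g.degree = 0
  · obtain ⟨c, hc⟩ : ∃ c, g = Polynomial.C c := ⟨_, Polynomial.eq_C_of_degree_eq_zero hroot⟩
    have hfc : f = Polynomial.C c * Polynomial.X ^ n := by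
      refine Polynomial.eq_of_infinite_eval_eq _ _
        ((Set.finite_singleton (0 : ℂ)).infinite_compl.mono ?_)
      intro s (hs : s ≠ 0)
      have h1 : eval (a + s⁻¹ • b) B = c := by
        rw [← eval_restrict_line, ← hg, hc, Polynomial.eval_C]
      have h2 : b + s • a = s • (a + s⁻¹ • b) := by
        rw [smul_add, smul_smul, mul_inv_cancel₀ hs, one_smul, add_comm]
      change f.eval s = _
      rw [hf, eval_restrict_line, h2, hB.eval_smul_eq, h1, Polynomial.eval_mul, Polynomial.eval_C,
        Polynomial.eval_pow, Polynomial.eval_X, mul_comm]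
    refine ⟨0, 1, fun h => one_ne_zero (hab 0 1 h).2, ?_⟩
    have h := eval_restrict_line B b a 0
    rw [← hf, hfc] at h
    simpa [hn] using h.symm
  · obtain ⟨t, ht⟩ := IsAlgClosed.exists_root g hroot
    refine ⟨1, t, fun h => one_ne_zero (hab 1 t h).1, ?_⟩
    rw [one_smul, ← eval_restrict_line]
    exact ht

lemma exists_linearIndependent_orthogonal (u : Fin 3 → ℂ) :
    ∃ a b : Fin 3 → ℂ, LinearIndependent ℂ ![a, b] ∧ u ⬝ᵥ a = 0 ∧ u ⬝ᵥ b = 0 := by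
  let φ : (Fin 3 → ℂ) →ₗ[ℂ] ℂ := dotProductBilin ℂ ℂ u
  have h1 : 1 < Module.finrank ℂ (LinearMap.ker φ) := by
    have h2 := φ.finrank_range_add_finrank_ker
    have h3 := (LinearMap.range φ).finrank_le
    rw [Module.finrank_fin_fun] at h2
    rw [Module.finrank_self] at h3
    omega
  have : Nontrivial (LinearMap.ker φ) := Module.nontrivial_of_finrank_pos (zero_lt_one.trans h1)
  obtain ⟨x, hx⟩ := exists_ne (0 : LinearMap.ker φ)
  obtain ⟨y, hy⟩ := exists_linearIndependent_pair_of_one_lt_finrank h1 hx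
  refine ⟨x, y, ?_, x.2, y.2⟩
  have h := hy.map' (LinearMap.ker φ).subtype (Submodule.ker_subtype _)
  rwa [← FinVec.map_eq] at h

/-- A smooth cubic has no linear factor. -/
lemma SmoothCubic.ne_mul {F A B : MvPolynomial (Fin 3) ℂ} (hF : SmoothCubic F)
    (hA : A.IsHomogeneous 1) (hB : B.IsHomogeneous 2) : F ≠ A * B := by
  rintro rfl
  obtain ⟨u, rfl⟩ := hA.exists_eq_linForm
  obtain ⟨a, b, hab, ha, hb⟩ := exists_linearIndependent_orthogonal u
  obtain ⟨s, t, hv, hBv⟩ := hB.exists_zero_on_line two_ne_zero hab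
  refine hv (hF.2 _ ?_)
  ext i
  have hu : eval (s • a + t • b) (linForm u) = 0 := by
    simp [dotProduct_add, dotProduct_smul, ha, hb]
  simp only [grad, Derivation.leibniz, smul_eq_mul, map_add, map_mul, hBv, hu]
  simp

section Points

open Finset Matrix

variable {ι : Type*} (P : ι → Fin 3 → ℂ)

/-- The forms of degree `d` vanishing at the points indexed by `T`. -/
def formsThrough (T : Finset ι) (d : ℕ) : Submodule ℂ (MvPolynomial (Fin 3) ℂ) where
  carrier := {A | A.IsHomogeneous d ∧ ∀ t ∈ T, eval (P t) A = 0}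
  zero_mem' := ⟨isHomogeneous_zero _ _ _, fun _ _ => map_zero _⟩
  add_mem' hA hB := ⟨hA.1.add hB.1, fun t ht => by rw [map_add, hA.2 t ht, hB.2 t ht, add_zero]⟩
  smul_mem' c A hA := ⟨(homogeneousSubmodule (Fin 3) ℂ d).smul_mem c hA.1, fun t ht => by
    rw [smul_eval, hA.2 t ht, mul_zero]⟩

lemma mem_formsThrough {T : Finset ι} {d : ℕ} {A : MvPolynomial (Fin 3) ℂ} :
    A ∈ formsThrough P T d ↔ A.IsHomogeneous d ∧ ∀ t ∈ T, eval (P t) A = 0 := Iff.rfl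

/-- Some form of degree `d` vanishes at the points indexed by `T` but not at `P q`. -/
def Separates (d : ℕ) (T : Finset ι) (q : ι) : Prop :=
  ∃ A ∈ formsThrough P T d, eval (P q) A ≠ 0

lemma formsThrough_le (T : Finset ι) (d : ℕ) :
    formsThrough P T d ≤ homogeneousSubmodule (Fin 3) ℂ d := fun _ hA => hA.1

instance finiteDimensional_formsThrough (T : Finset ι) (d : ℕ) :
    FiniteDimensional ℂ (formsThrough P T d) :=
  Submodule.finiteDimensional_of_le (formsThrough_le P T d)

variable {P}

lemma separates_zero_empty (q : ι) : Separates P 0 ∅ q :=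
  ⟨1, ⟨isHomogeneous_one _ _, by simp⟩, by simp⟩

lemma Separates.mul_linForm {d : ℕ} {S T : Finset ι} {q : ι} (h : Separates P d S q)
    {u : Fin 3 → ℂ} (hq : u ⬝ᵥ P q ≠ 0) (hT : ∀ t ∈ T, t ∈ S ∨ u ⬝ᵥ P t = 0) :
    Separates P (d + 1) T q := by
  obtain ⟨A, hA, hAq⟩ := h
  refine ⟨A * linForm u, ⟨hA.1.mul (isHomogeneous_linForm u), fun t ht => ?_⟩, ?_⟩
  · rw [map_mul, eval_linForm]
    rcases hT t ht with h | h
    · rw [hA.2 t h, zero_mul]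
    · rw [h, mul_zero]
  · rw [map_mul, eval_linForm]
    exact mul_ne_zero hAq hq

variable [DecidableEq ι]

/-- Points imposing independent conditions on forms of degree `d`. -/
lemma finrank_formsThrough {T : Finset ι} {d : ℕ}
    (hT : ∀ t ∈ T, Separates P d (T.erase t) t) :
    Module.finrank ℂ (formsThrough P T d) + T.card = (d + 2).choose d := by
  let f : homogeneousSubmodule (Fin 3) ℂ d →ₗ[ℂ] (T → ℂ) :=
    (LinearMap.pi fun t : T => (aeval (R := ℂ) (P t)).toLinearMap) ∘ₗ Submodule.subtype _
  have hf : ∀ A t, f A t = eval (P t) A.1 := fun A t => by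
    simp [f]
  have hker : formsThrough P T d = (LinearMap.ker f).map (Submodule.subtype _) := by
    ext A
    simp only [Submodule.mem_map, LinearMap.mem_ker, Submodule.subtype_apply, Subtype.exists,
      exists_and_right, exists_eq_right, mem_formsThrough, mem_homogeneousSubmodule]
    refine ⟨fun h => ⟨h.1, ?_⟩, fun ⟨h, h'⟩ => ⟨h, fun t ht => ?_⟩⟩
    · ext t
      rw [hf]
      exact h.2 t t.2
    · have := congrFun h' ⟨t, ht⟩
      rwa [hf] at this
  have hrange : LinearMap.range f = ⊤ := by
    refine eq_top_iff.2 fun x _ => ?_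
    rw [pi_eq_sum_univ' x]
    refine Submodule.sum_mem _ fun t _ => Submodule.smul_mem _ _ ?_
    obtain ⟨A, hA, hAt⟩ := hT t t.2
    refine ⟨(eval (P t) A)⁻¹ • ⟨A, hA.1⟩, ?_⟩
    ext s
    rw [map_smul, Pi.smul_apply, hf]
    rcases eq_or_ne t s with rfl | hst
    · simp [hAt]
    · rw [Pi.single_eq_of_ne hst.symm, smul_eq_mul]
      change _ * eval (P s) A = 0
      rw [hA.2 s (Finset.mem_erase.2 ⟨fun h => hst (Subtype.ext h.symm), s.2⟩), mul_zero]
  have h := f.finrank_range_add_finrank_ker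
  rw [hrange, finrank_top, Module.finrank_fintype_fun_eq_card, Fintype.card_coe,
    finrank_homogeneousSubmodule_fin_three] at h
  rw [hker, Submodule.finrank_map_subtype_eq]
  omega

/-- If the form `Q` vanishes on points imposing independent conditions in degree `e + m`, and there
are enough of them, then `Q` divides all forms of degree `e + m` through these points. -/
lemma exists_eq_mul_of_mem_formsThrough {T : Finset ι} {e m : ℕ}
    (hT : ∀ t ∈ T, Separates P (e + m) (T.erase t) t) {Q F : MvPolynomial (Fin 3) ℂ} (hQ0 : Q ≠ 0)
    (hQ : Q ∈ formsThrough P T e)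
    (hcard : (e + m + 2).choose (e + m) ≤ (m + 2).choose m + T.card)
    (hF : F ∈ formsThrough P T (e + m)) :
    ∃ A : MvPolynomial (Fin 3) ℂ, A.IsHomogeneous m ∧ F = Q * A := by
  have hle : (homogeneousSubmodule (Fin 3) ℂ m).map (LinearMap.mulLeft ℂ Q) ≤
      formsThrough P T (e + m) := by
    rintro _ ⟨A, hA, rfl⟩
    exact ⟨hQ.1.mul hA, fun t ht => by
      rw [LinearMap.mulLeft_apply, map_mul, hQ.2 t ht, zero_mul]⟩
  have hinj : Function.Injective (LinearMap.mulLeft ℂ Q) := fun A B h => mul_left_cancel₀ hQ0 h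
  have hrank := ((homogeneousSubmodule (Fin 3) ℂ m).equivMapOfInjective _ hinj).finrank_eq
  rw [finrank_homogeneousSubmodule_fin_three] at hrank
  have heq := Submodule.eq_of_le_of_finrank_le hle (by
    have := finrank_formsThrough hT
    omega)
  rw [← heq] at hF
  obtain ⟨A, hA, rfl⟩ := hF
  exact ⟨A, hA, rfl⟩

lemma Separates.of_erase_erase {d : ℕ} {T : Finset ι} {q a b : ι}
    (h : Separates P d ((T.erase a).erase b) q) (hab : (P q ⨯₃ P a) ⬝ᵥ P b ≠ 0) :
    Separates P (d + 1) T q := by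
  refine h.mul_linForm (u := P a ⨯₃ P b) ?_ fun t ht => ?_
  · rwa [dotProduct_comm, triple_product_permutation, triple_product_permutation, dotProduct_comm]
  · by_cases hta : t = a
    · subst hta
      exact Or.inr (by rw [dotProduct_comm, dot_self_cross])
    by_cases htb : t = b
    · subst htb
      exact Or.inr (by rw [dotProduct_comm, dot_cross_self])
    exact Or.inl (by simp [hta, htb, ht])

/-- `n` points impose independent conditions on forms of degree `n - 1`. -/
lemma separates_card (hP : ∀ i j, i ≠ j → P i ⨯₃ P j ≠ 0) (T : Finset ι) (q : ι) (hq : q ∉ T) :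
    Separates P T.card T q := by
  induction T using Finset.induction_on with
  | empty => exact separates_zero_empty q
  | insert a T ha ih =>
    rw [card_insert_of_notMem ha]
    have hqa : q ≠ a := fun h => hq (h ▸ mem_insert_self _ _)
    obtain ⟨w, hw⟩ : ∃ w, (P q ⨯₃ P a) ⬝ᵥ w ≠ 0 := by
      by_contra! h
      exact hP q a hqa (dotProduct_eq_zero _ h)
    refine (ih fun h => hq (mem_insert_of_mem h)).mul_linForm (u := P a ⨯₃ w) ?_ fun t ht => ?_
    · rwa [dotProduct_comm, triple_product_permutation, triple_product_permutation,
        dotProduct_comm]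
    · rcases mem_insert.1 ht with rfl | h
      · exact Or.inr (by rw [dotProduct_comm, dot_self_cross])
      · exact Or.inl h

/-- No four of the points of the family lie on a line. -/
def NoFourCollinear (P : ι → Fin 3 → ℂ) : Prop :=
  ∀ T : Finset ι, T.card = 4 → ∀ u ≠ 0, ∃ t ∈ T, u ⬝ᵥ P t ≠ 0

lemma SmoothCubic.noFourCollinear {F : MvPolynomial (Fin 3) ℂ} (hF : SmoothCubic F)
    (hP : ∀ i j, i ≠ j → P i ⨯₃ P j ≠ 0) (hFP : ∀ i, eval (P i) F = 0) : NoFourCollinear P := by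
  intro T hT u hu
  by_contra! h
  obtain ⟨A, hA, hFA⟩ := exists_eq_mul_of_mem_formsThrough (P := P) (T := T) (e := 1) (m := 2)
    (fun t ht => by
      have := separates_card hP (T.erase t) t (notMem_erase t T)
      rwa [card_erase_of_mem ht, hT] at this)
    (linForm_ne_zero hu) ⟨isHomogeneous_linForm u, fun t ht => by rw [eval_linForm, h t ht]⟩
    (by rw [hT]; decide) ⟨hF.1.2, fun t _ => hFP t⟩
  exact hF.ne_mul (isHomogeneous_linForm u) hA hFA

/-- A line through two of the points contains at most one further point. -/
lemma NoFourCollinear.dot_cross_ne_zero_or (h4 : NoFourCollinear P)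
    (hP : ∀ i j, i ≠ j → P i ⨯₃ P j ≠ 0) {q a b c : ι} (hqa : q ≠ a) (hqb : q ≠ b) (hqc : q ≠ c)
    (hab : a ≠ b) (hac : a ≠ c) (hbc : b ≠ c) :
    (P q ⨯₃ P a) ⬝ᵥ P b ≠ 0 ∨ (P q ⨯₃ P a) ⬝ᵥ P c ≠ 0 := by
  obtain ⟨t, ht, hne⟩ := h4 {q, a, b, c}
    (by simp [card_insert_of_notMem, *]) _ (hP q a hqa)
  simp only [mem_insert, mem_singleton] at ht
  rcases ht with rfl | rfl | rfl | rfl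
  · exact absurd (by rw [dotProduct_comm, dot_self_cross]) hne
  · exact absurd (by rw [dotProduct_comm, dot_cross_self]) hne
  · exact Or.inl hne
  · exact Or.inr hne

lemma NoFourCollinear.exists_two_partners (h4 : NoFourCollinear P)
    (hP : ∀ i j, i ≠ j → P i ⨯₃ P j ≠ 0) {T : Finset ι} {q a : ι} (hq : q ∉ T) (ha : a ∈ T)
    (hT : 4 ≤ T.card) :
    ∃ b ∈ T.erase a, ∃ c ∈ T.erase a, b ≠ c ∧
      (P q ⨯₃ P a) ⬝ᵥ P b ≠ 0 ∧ (P q ⨯₃ P a) ⬝ᵥ P c ≠ 0 := by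
  have hcard : 2 < (T.erase a).card := by rw [card_erase_of_mem ha]; omega
  obtain ⟨x, hx, y, hy, z, hz, hxy, hxz, hyz⟩ := two_lt_card.1 hcard
  have key : ∀ b ∈ T.erase a, ∀ c ∈ T.erase a, b ≠ c →
      (P q ⨯₃ P a) ⬝ᵥ P b ≠ 0 ∨ (P q ⨯₃ P a) ⬝ᵥ P c ≠ 0 := fun b hb c hc hbc =>
    h4.dot_cross_ne_zero_or hP (fun h => hq (h ▸ ha))
      (fun h => hq (h ▸ mem_of_mem_erase hb)) (fun h => hq (h ▸ mem_of_mem_erase hc))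
      (ne_of_mem_erase hb).symm (ne_of_mem_erase hc).symm hbc
  have h1 := key x hx y hy hxy
  have h2 := key x hx z hz hxz
  have h3 := key y hy z hz hyz
  by_cases hX : (P q ⨯₃ P a) ⬝ᵥ P x = 0
  · exact ⟨y, hy, z, hz, hyz, by tauto, by tauto⟩
  by_cases hY : (P q ⨯₃ P a) ⬝ᵥ P y = 0
  · exact ⟨x, hx, z, hz, hxz, by tauto, by tauto⟩
  exact ⟨x, hx, y, hy, hxy, hX, hY⟩

lemma NoFourCollinear.separates_two (h4 : NoFourCollinear P)
    (hP : ∀ i j, i ≠ j → P i ⨯₃ P j ≠ 0) {T : Finset ι} {q : ι} (hq : q ∉ T) (hT : T.card = 4) :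
    Separates P 2 T q := by
  obtain ⟨a, ha⟩ : T.Nonempty := card_pos.1 (by omega)
  obtain ⟨b, hb, c, hc, hbc, hqb, hqc⟩ := h4.exists_two_partners hP hq ha (by omega)
  have hca : c ∈ (T.erase a).erase b := mem_erase.2 ⟨hbc.symm, hc⟩
  obtain ⟨d, hd⟩ : (((T.erase a).erase b).erase c).Nonempty := card_pos.1 (by
    rw [card_erase_of_mem hca, card_erase_of_mem hb, card_erase_of_mem ha]; omega)
  simp only [mem_erase] at hb hc hd
  have hempty : ((((T.erase a).erase b).erase d).erase c) = ∅ := card_eq_zero.1 (by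
    rw [card_erase_of_mem, card_erase_of_mem, card_erase_of_mem, card_erase_of_mem, hT] <;>
      simp_all [eq_comm])
  have hempty' : ((((T.erase a).erase c).erase d).erase b) = ∅ := by
    rw [← hempty]
    ext x
    simp only [mem_erase]
    tauto
  rcases h4.dot_cross_ne_zero_or hP (q := q) (a := d) (b := b) (c := c)
    (fun h => hq (h ▸ hd.2.2.2)) (fun h => hq (h ▸ hb.2)) (fun h => hq (h ▸ hc.2))
    hd.2.1 hd.1 hbc with h | h
  · exact .of_erase_erase (.of_erase_erase (hempty' ▸ separates_zero_empty q) h) hqc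
  · exact .of_erase_erase (.of_erase_erase (hempty ▸ separates_zero_empty q) h) hqb

lemma NoFourCollinear.separates_three_of_card_six (h4 : NoFourCollinear P)
    (hP : ∀ i j, i ≠ j → P i ⨯₃ P j ≠ 0) {T : Finset ι} {q : ι} (hq : q ∉ T) (hT : T.card = 6) :
    Separates P 3 T q := by
  obtain ⟨a, ha⟩ : T.Nonempty := card_pos.1 (by omega)
  obtain ⟨b, hb, -, -, -, hqb, -⟩ := h4.exists_two_partners hP hq ha (by omega)
  refine .of_erase_erase (h4.separates_two hP ?_ ?_) hqb
  · exact fun h => hq (mem_of_mem_erase (mem_of_mem_erase h))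
  · rw [card_erase_of_mem hb, card_erase_of_mem ha, hT]

/-- No seven points on a smooth cubic lie on a conic. -/
lemma SmoothCubic.exists_eval_ne_zero_of_card_seven {F : MvPolynomial (Fin 3) ℂ}
    (hF : SmoothCubic F) (hP : ∀ i j, i ≠ j → P i ⨯₃ P j ≠ 0) (hFP : ∀ i, eval (P i) F = 0)
    {T : Finset ι} (hT : T.card = 7) {Q : MvPolynomial (Fin 3) ℂ} (hQ0 : Q ≠ 0) :
    Q ∉ formsThrough P T 2 := by
  intro hQ
  obtain ⟨A, hA, hFA⟩ := exists_eq_mul_of_mem_formsThrough (P := P) (T := T) (e := 2) (m := 1)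
    (fun t ht => (hF.noFourCollinear hP hFP).separates_three_of_card_six hP (notMem_erase t T)
      (by rw [card_erase_of_mem ht, hT])) hQ0 hQ (by rw [hT]; decide) ⟨hF.1.2, fun t _ => hFP t⟩
  exact hF.ne_mul hA hQ.1 (by rw [hFA, mul_comm])

lemma NoFourCollinear.finrank_conics (h4 : NoFourCollinear P)
    (hP : ∀ i j, i ≠ j → P i ⨯₃ P j ≠ 0) {T : Finset ι} (hT : T.card = 5) :
    Module.finrank ℂ (formsThrough P T 2) = 1 := by
  have h := finrank_formsThrough (P := P) (T := T) (d := 2) fun t ht =>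
    h4.separates_two hP (notMem_erase t T) (by rw [card_erase_of_mem ht, hT])
  rw [hT, show Nat.choose (2 + 2) 2 = 6 by decide] at h
  omega

lemma SmoothCubic.separates_three_of_card_seven {F : MvPolynomial (Fin 3) ℂ}
    (hF : SmoothCubic F) (hP : ∀ i j, i ≠ j → P i ⨯₃ P j ≠ 0) (hFP : ∀ i, eval (P i) F = 0)
    {T : Finset ι} {q : ι} (hq : q ∉ T) (hT : T.card = 7) : Separates P 3 T q := by
  have h4 := hF.noFourCollinear hP hFP
  obtain ⟨a, ha⟩ : T.Nonempty := card_pos.1 (by omega)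
  obtain ⟨b, hb, c, hc, hbc, hqb, hqc⟩ := h4.exists_two_partners hP hq ha (by omega)
  by_contra hsep
  have key : ∀ x ∈ T.erase a, (P q ⨯₃ P a) ⬝ᵥ P x ≠ 0 →
      ∃ Q ≠ 0, Q ∈ formsThrough P (insert q ((T.erase a).erase x)) 2 := by
    intro x hx hqx
    have hrank := h4.finrank_conics hP (T := (T.erase a).erase x)
      (by rw [card_erase_of_mem hx, card_erase_of_mem ha, hT])
    obtain ⟨Q, hQ, hQ0⟩ := Submodule.exists_mem_ne_zero_of_ne_bot
      (Submodule.one_le_finrank_iff.1 hrank.ge)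
    refine ⟨Q, hQ0, hQ.1, fun t ht => ?_⟩
    rcases mem_insert.1 ht with rfl | ht
    · by_contra hne
      exact hsep (.of_erase_erase ⟨Q, hQ, hne⟩ hqx)
    · exact hQ.2 t ht
  obtain ⟨Q, hQ0, hQ⟩ := key b hb hqb
  obtain ⟨R, hR0, hR⟩ := key c hc hqc
  have hcb : c ∈ (T.erase a).erase b := mem_erase.2 ⟨hbc.symm, hc⟩
  have hT5 : (insert q (((T.erase a).erase b).erase c)).card = 5 := by
    rw [card_insert_of_notMem (by simp [hq]), card_erase_of_mem hcb, card_erase_of_mem hb,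
      card_erase_of_mem ha, hT]
  obtain ⟨A, -, hRA⟩ := exists_eq_mul_of_mem_formsThrough (P := P)
    (T := insert q (((T.erase a).erase b).erase c)) (e := 2) (m := 0) (F := R)
    (fun t ht => h4.separates_two hP (notMem_erase t _) (by rw [card_erase_of_mem ht, hT5]))
    hQ0 ⟨hQ.1, fun t ht => hQ.2 t (by simp only [mem_insert, mem_erase] at ht ⊢; tauto)⟩
    (by rw [hT5]; decide)
    ⟨hR.1, fun t ht => hR.2 t (by simp only [mem_insert, mem_erase] at ht ⊢; tauto)⟩
  refine hF.exists_eval_ne_zero_of_card_seven hP hFP (T := insert q (T.erase a)) ?_ hR0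
    ⟨hR.1, fun t ht => ?_⟩
  · rw [card_insert_of_notMem (by simp [hq]), card_erase_of_mem ha, hT]
  · by_cases htc : t = c
    · rw [hRA, map_mul, htc, hQ.2 c (mem_insert_of_mem hcb), zero_mul]
    · exact hR.2 t (by simp only [mem_insert, mem_erase] at ht ⊢; tauto)

end Points

lemma Transverse.linearIndependent {F G : MvPolynomial (Fin 3) ℂ} {v : Fin 3 → ℂ}
    (h : Transverse F G v) : LinearIndependent ℂ ![F, G] := by
  rw [Transverse, LinearIndependent.pair_iff] at h
  rw [LinearIndependent.pair_iff]
  refine fun s t hst => h s t ?_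
  ext i
  have := congrArg (fun A => eval v (pderiv i A)) hst
  simpa [grad, smul_eval] using this

lemma crossProduct_ne_zero_of_not_sameProjPt {u v : Fin 3 → ℂ} (hu : u ≠ 0) (hv : v ≠ 0)
    (h : ¬ SameProjPt u v) : crossProduct u v ≠ 0 := by
  rw [crossProduct_ne_zero_iff_linearIndependent, LinearIndependent.pair_iff' hu]
  rintro c rfl
  exact h ⟨c, fun hc => hv (by rw [hc, zero_smul]), rfl⟩

/-- A cubic vanishing at eight of the nine transversal intersection points of
two smooth cubics `F`, `G` lies in the pencil spanned by `F` and `G`. -/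
theorem cubic_through_eight_points_mem_pencil
    (F G : MvPolynomial (Fin 3) ℂ) (hF : SmoothCubic F) (hG : SmoothCubic G)
    (p : Fin 9 → Fin 3 → ℂ) (hp : NinePoints F G p)
    (htrans : ∀ i, Transverse F G (p i))
    (H : MvPolynomial (Fin 3) ℂ) (hH : IsCubic H)
    (j : Fin 9) (hvan : ∀ i, i ≠ j → eval (p i) H = 0) :
    ∃ α β : ℂ, H = α • F + β • G := by
  classical
  have hcross : ∀ i k, i ≠ k → crossProduct (p i) (p k) ≠ 0 := fun i k hik =>
    crossProduct_ne_zero_of_not_sameProjPt (hp.1 i) (hp.1 k) (hp.2.1 i k hik)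
  have hT : (Finset.univ.erase j).card = 8 := by
    rw [Finset.card_erase_of_mem (Finset.mem_univ j), Finset.card_univ, Fintype.card_fin]
  have hrank := finrank_formsThrough (P := p) (T := Finset.univ.erase j) (d := 3) fun t ht =>
    hF.separates_three_of_card_seven hcross (fun i => (hp.2.2.1 i).1) (Finset.notMem_erase t _)
      (by rw [Finset.card_erase_of_mem ht, hT])
  rw [hT, show Nat.choose (3 + 2) 3 = 10 by decide] at hrank
  have hspan : Submodule.span ℂ (Set.range ![F, G]) = formsThrough p (Finset.univ.erase j) 3 := by
    refine Submodule.eq_of_le_of_finrank_le ?_ ?_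
    · rw [Submodule.span_le, Set.range_subset_iff]
      intro i
      fin_cases i
      · exact ⟨hF.1.2, fun t _ => (hp.2.2.1 t).1⟩
      · exact ⟨hG.1.2, fun t _ => (hp.2.2.1 t).2⟩
    · rw [finrank_span_eq_card (htrans j).linearIndependent, Fintype.card_fin]
      omega
  have hmem : H ∈ formsThrough p (Finset.univ.erase j) 3 :=
    ⟨hH.2, fun t ht => hvan t (Finset.ne_of_mem_erase ht)⟩
  rw [← hspan, Matrix.range_cons_cons_empty, Submodule.mem_span_pair] at hmem
  obtain ⟨α, β, h⟩ := hmem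
  exact ⟨α, β, h.symm⟩
end

section
/- Let F and G be smooth cubics in ℂ[X,Y,Z] whose common projective zero set consists of exactly nine distinct points p₁,…,p₉ of ℙ², with F and G meeting transversally at each of these points. Then for every integer k with 2 ≤ k ≤ 9 there exists a smooth cubic H such that: H vanishes at each of p_{k+1},…,p₉; H does not vanish at any of p₁,…,p_k; and at each point p_j with k+1 ≤ j ≤ 9, H meets F transversally and H meets G transversally. -/
open MvPolynomial

open scoped Matrix

theorem eval_smul_of_isHomogeneous {H : MvPolynomial (Fin 3) ℂ} {n : ℕ} (hH : H.IsHomogeneous n)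
    (c : ℂ) (v : Fin 3 → ℂ) : eval (c • v) H = c ^ n * eval v H := by
  rw [eval_eq', eval_eq', Finset.mul_sum]
  refine Finset.sum_congr rfl fun d hd => ?_
  have h : n = d.degree := hH.degree_eq_sum_deg_support hd
  simp only [Pi.smul_apply, smul_eq_mul, mul_pow, Finset.prod_mul_distrib,
    Finset.prod_pow_eq_pow_sum]
  rw [← Finsupp.degree_eq_sum, ← h]
  ring

theorem coeff_aeval_of_isHomogeneous {H : MvPolynomial (Fin 3) ℂ} {m n : ℕ}
    (hH : H.IsHomogeneous m) (f : Fin 3 → Polynomial ℂ) (hf : ∀ i, (f i).natDegree ≤ n) :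
    (aeval f H).coeff (m * n) = eval (fun i => (f i).coeff n) H := by
  rw [aeval_eq_eval₂Hom, coe_eval₂Hom, eval₂_eq', eval_eq', Polynomial.finsetSum_coeff]
  refine Finset.sum_congr rfl fun d hd => ?_
  have h : m = d.degree := hH.degree_eq_sum_deg_support hd
  rw [Finsupp.degree_eq_sum, Fin.sum_univ_three] at h
  have hp : ∀ i k, (f i ^ k).natDegree ≤ k * n := fun i k =>
    Polynomial.natDegree_pow_le_of_le k (hf i)
  rw [Polynomial.algebraMap_eq, Polynomial.coeff_C_mul, Fin.prod_univ_three,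
    Fin.prod_univ_three, h, add_mul, add_mul,
    Polynomial.coeff_mul_add_eq_of_natDegree_le
      (Polynomial.natDegree_mul_le_of_le (hp _ _) (hp _ _)) (hp _ _),
    Polynomial.coeff_mul_add_eq_of_natDegree_le (hp _ _) (hp _ _),
    Polynomial.coeff_pow_of_natDegree_le (hf _), Polynomial.coeff_pow_of_natDegree_le (hf _),
    Polynomial.coeff_pow_of_natDegree_le (hf _)]

theorem eval_aeval_curve (H : MvPolynomial (Fin 3) ℂ) (f : Fin 3 → Polynomial ℂ) (t : ℂ) :
    (aeval f H).eval t = eval (fun i => (f i).eval t) H := by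
  rw [aeval_eq_eval₂Hom, coe_eval₂Hom, eval₂_eq', eval_eq', Polynomial.eval_finsetSum]
  simp [Polynomial.eval_prod]

/-- A cubic vanishing at `3 n` finite parameters of a rational curve of degree `n`, and at the
point with infinite parameter, vanishes on the whole curve. -/
theorem eval_curve_eq_zero {H : MvPolynomial (Fin 3) ℂ} (hH : H.IsHomogeneous 3) {n : ℕ}
    (hn : 0 < n) (f : Fin 3 → Polynomial ℂ) (hf : ∀ i, (f i).natDegree ≤ n)
    (hinf : eval (fun i => (f i).coeff n) H = 0) (s : Finset ℂ) (hs : 3 * n ≤ s.card)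
    (h0 : ∀ t ∈ s, eval (fun i => (f i).eval t) H = 0) (t : ℂ) :
    eval (fun i => (f i).eval t) H = 0 := by
  have hdeg := MvPolynomial.aeval_natDegree_le H hH.totalDegree_le f hf
  have hdeg' := Polynomial.natDegree_le_pred hdeg
    ((coeff_aeval_of_isHomogeneous hH f hf).trans hinf)
  have hz : aeval f H = 0 := by
    refine Polynomial.eq_zero_of_natDegree_lt_card_of_eval_eq_zero' _ s
      (fun t ht => (eval_aeval_curve H f t).trans (h0 t ht)) ?_
    omega
  rw [← eval_aeval_curve, hz, Polynomial.eval_zero]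

/-- No rational curve of degree `n` with an injective nowhere vanishing parametrization passes
through `3 n + 1` of the nine points, one of them being the point with infinite parameter. -/
theorem NinePoints.not_curve {F G : MvPolynomial (Fin 3) ℂ} {p : Fin 9 → Fin 3 → ℂ}
    (hp : NinePoints F G p) (hF : F.IsHomogeneous 3) (hG : G.IsHomogeneous 3) {n : ℕ}
    (hn : 0 < n) (f : Fin 3 → Polynomial ℂ) (hf : ∀ i, (f i).natDegree ≤ n)
    (hne : ∀ t, (fun i => (f i).eval t) ≠ 0)
    (hinj : ∀ t t' c : ℂ, (fun i => (f i).eval t) = c • (fun i => (f i).eval t') → t = t')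
    (k : Fin 9) (c : ℂ) (hinf : (fun i => (f i).coeff n) = c • p k)
    (s : Finset (Fin 9)) (hs : 3 * n ≤ s.card)
    (h : ∀ j ∈ s, ∃ t a : ℂ, a ≠ 0 ∧ (fun i => (f i).eval t) = a • p j) : False := by
  choose! T a ha hT using h
  have hTinj : Set.InjOn T s := by
    intro i hi j hj hij
    by_contra hne'
    refine hp.2.1 i j hne' ⟨(a j)⁻¹ * a i, mul_ne_zero (inv_ne_zero (ha j hj)) (ha i hi), ?_⟩
    rw [mul_smul, ← hT i hi, hij, hT j hj, smul_smul, inv_mul_cancel₀ (ha j hj), one_smul]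
  have hcard : 3 * n ≤ (s.image T).card := by rwa [Finset.card_image_of_injOn hTinj]
  have key : ∀ H : MvPolynomial (Fin 3) ℂ, H.IsHomogeneous 3 → (∀ i, eval (p i) H = 0) →
      ∀ t, eval (fun i => (f i).eval t) H = 0 := by
    intro H hH hz
    refine eval_curve_eq_zero hH hn f hf ?_ _ hcard ?_
    · rw [hinf, eval_smul_of_isHomogeneous hH, hz, mul_zero]
    · simp only [Finset.mem_image]
      rintro _ ⟨j, hj, rfl⟩
      rw [hT j hj, eval_smul_of_isHomogeneous hH, hz, mul_zero]
  have hall := fun t => hp.2.2.2 _ (hne t) (key F hF (fun i => (hp.2.2.1 i).1) t)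
    (key G hG (fun i => (hp.2.2.1 i).2) t)
  choose I b hb hI using hall
  refine not_injective_infinite_finite I fun t t' htt => hinj t t' (b t * (b t')⁻¹) ?_
  rw [← hI t, ← hI t', htt, smul_smul, mul_assoc, inv_mul_cancel₀ (hb t'), mul_one]

theorem NinePoints.cross_ne_zero {F G : MvPolynomial (Fin 3) ℂ} {p : Fin 9 → Fin 3 → ℂ}
    (hp : NinePoints F G p) {i j : Fin 9} (hij : i ≠ j) : p i ⨯₃ p j ≠ 0 := by
  rw [crossProduct_ne_zero_iff_linearIndependent,
    LinearIndependent.pair_iff' (hp.1 i)]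
  rintro c hc
  refine hp.2.1 i j hij ⟨c, ?_, hc⟩
  rintro rfl
  exact hp.1 j (by rw [← hc, zero_smul])

theorem eq_zero_of_smul_add_smul_eq_zero {a b : Fin 3 → ℂ} (h : a ⨯₃ b ≠ 0) (x y : ℂ)
    (hxy : x • a + y • b = 0) : x = 0 ∧ y = 0 := by
  rw [crossProduct_ne_zero_iff_linearIndependent, LinearIndependent.pair_iff] at h
  exact h x y hxy

theorem exists_relation_of_dotProduct_eq_zero {l a b c : Fin 3 → ℂ} (hl : l ≠ 0)
    (ha : l ⬝ᵥ a = 0) (hb : l ⬝ᵥ b = 0) (hc : l ⬝ᵥ c = 0) :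
    ∃ x y z : ℂ, (x ≠ 0 ∨ y ≠ 0 ∨ z ≠ 0) ∧ x • a + y • b + z • c = 0 := by
  have hdet : (Matrix.of ![a, b, c]).det = 0 := by
    refine Matrix.exists_mulVec_eq_zero_iff.1 ⟨l, hl, ?_⟩
    ext i
    rw [Matrix.mulVec, dotProduct_comm]
    fin_cases i <;> assumption
  obtain ⟨w, hw, h⟩ := Matrix.exists_vecMul_eq_zero_iff.2 hdet
  refine ⟨w 0, w 1, w 2, ?_, ?_⟩
  · by_contra! hcon
    exact hw (by ext i; fin_cases i <;> simp [hcon])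
  · rw [← h]
    ext i
    simp [Matrix.vecMul, dotProduct, Fin.sum_univ_three]

/-- No four of the nine points are collinear. -/
theorem NinePoints.line_eq_zero {F G : MvPolynomial (Fin 3) ℂ} {p : Fin 9 → Fin 3 → ℂ}
    (hp : NinePoints F G p) (hF : F.IsHomogeneous 3) (hG : G.IsHomogeneous 3)
    (s : Finset (Fin 9)) (hs : 4 ≤ s.card) (l : Fin 3 → ℂ) (hl : ∀ i ∈ s, l ⬝ᵥ p i = 0) :
    l = 0 := by
  by_contra hl0
  obtain ⟨k, hk⟩ : s.Nonempty := Finset.card_pos.1 (by omega)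
  have hcard : 3 ≤ (s.erase k).card := by rw [Finset.card_erase_of_mem hk]; omega
  obtain ⟨m, hm⟩ : (s.erase k).Nonempty := Finset.card_pos.1 (by omega)
  obtain ⟨hmk, hms⟩ := Finset.mem_erase.1 hm
  have hind := eq_zero_of_smul_add_smul_eq_zero (hp.cross_ne_zero hmk)
  obtain ⟨f, hfdef⟩ : ∃ f : Fin 3 → Polynomial ℂ,
      f = fun i => Polynomial.C (p k i) * Polynomial.X + Polynomial.C (p m i) := ⟨_, rfl⟩
  have hev : ∀ t, (fun i => (f i).eval t) = p m + t • p k := by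
    intro t; ext i; simp [hfdef]; ring
  refine hp.not_curve hF hG one_pos f (fun i => hfdef ▸ Polynomial.natDegree_linear_le) ?_ ?_ k 1 ?_
    (s.erase k) (by simpa using hcard) ?_
  · intro t h0
    rw [hev] at h0
    exact one_ne_zero (hind 1 t (by rw [one_smul, h0])).1
  · intro t t' c h
    rw [hev, hev] at h
    obtain ⟨h1, h2⟩ := hind (1 - c) (t - c * t') (by
      rw [← sub_eq_zero.2 h]; module)
    have hc : c = 1 := by linear_combination -h1
    rw [hc] at h2
    linear_combination h2
  · ext i; simp [hfdef, Polynomial.coeff_C]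
  · intro j hj
    obtain ⟨hjk, hjs⟩ := Finset.mem_erase.1 hj
    by_cases hjm : j = m
    · exact ⟨0, 1, one_ne_zero, by rw [hev, hjm]; simp⟩
    obtain ⟨x, y, z, hne, hrel⟩ := exists_relation_of_dotProduct_eq_zero hl0
      (hl k hk) (hl m hms) (hl j hjs)
    have hind2 := eq_zero_of_smul_add_smul_eq_zero (hp.cross_ne_zero hjk)
    have hy : y ≠ 0 := by
      rintro rfl
      obtain ⟨h1, h2⟩ := hind2 z x (by rw [← hrel, zero_smul]; abel)
      simp [h1, h2] at hne
    have hz : z ≠ 0 := by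
      rintro rfl
      obtain ⟨h1, h2⟩ := hind y x (by rw [← hrel, zero_smul]; abel)
      exact hy h1
    refine ⟨x / y, -z / y, div_ne_zero (neg_ne_zero.2 hz) hy, ?_⟩
    rw [hev]
    ext i
    have := congrFun hrel i
    simp at this ⊢
    field_simp
    linear_combination this

/-- The values of the six quadratic monomials at `v`. -/
def veronese (v : Fin 3 → ℂ) : Fin 6 → ℂ :=
  ![v 0 ^ 2, v 1 ^ 2, v 2 ^ 2, v 1 * v 2, v 0 * v 2, v 0 * v 1]

/-- The coefficients of the conic which is the union of the lines `l` and `m`. -/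
def lineProduct (l m : Fin 3 → ℂ) : Fin 6 → ℂ :=
  ![l 0 * m 0, l 1 * m 1, l 2 * m 2, l 1 * m 2 + l 2 * m 1, l 0 * m 2 + l 2 * m 0,
    l 0 * m 1 + l 1 * m 0]

/-- The polar form of the quadratic form with coefficients `c`. -/
def conicPolar (c : Fin 6 → ℂ) (a b : Fin 3 → ℂ) : ℂ :=
  c ⬝ᵥ veronese (a + b) - c ⬝ᵥ veronese a - c ⬝ᵥ veronese b

theorem dotProduct_veronese (c : Fin 6 → ℂ) (v : Fin 3 → ℂ) :
    c ⬝ᵥ veronese v = c 0 * v 0 ^ 2 + c 1 * v 1 ^ 2 + c 2 * v 2 ^ 2 + c 3 * (v 1 * v 2) +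
      c 4 * (v 0 * v 2) + c 5 * (v 0 * v 1) := by
  simp [dotProduct, Fin.sum_univ_six, veronese]

theorem lineProduct_dotProduct_veronese (l m v : Fin 3 → ℂ) :
    lineProduct l m ⬝ᵥ veronese v = (l ⬝ᵥ v) * (m ⬝ᵥ v) := by
  rw [dotProduct_veronese]
  simp [lineProduct, dotProduct, Fin.sum_univ_three]
  ring

theorem dotProduct_veronese_smul (c : Fin 6 → ℂ) (d : ℂ) (v : Fin 3 → ℂ) :
    c ⬝ᵥ veronese (d • v) = d ^ 2 * (c ⬝ᵥ veronese v) := by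
  simp only [dotProduct_veronese, Pi.smul_apply, smul_eq_mul]
  ring

theorem dotProduct_veronese_combination (q : Fin 6 → ℂ) (a b c : Fin 3 → ℂ) (x y z : ℂ) :
    q ⬝ᵥ veronese (x • a + y • b + z • c) =
      x ^ 2 * (q ⬝ᵥ veronese a) + y ^ 2 * (q ⬝ᵥ veronese b) + z ^ 2 * (q ⬝ᵥ veronese c) +
        y * z * conicPolar q b c + x * z * conicPolar q c a + x * y * conicPolar q a b := by
  simp only [conicPolar, dotProduct_veronese, Pi.smul_apply, Pi.add_apply, smul_eq_mul]
  ring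

theorem eq_zero_of_forall_dotProduct_veronese (q : Fin 6 → ℂ)
    (h : ∀ v, q ⬝ᵥ veronese v = 0) : q = 0 := by
  simp only [dotProduct_veronese] at h
  have h0 := h ![1, 0, 0]
  have h1 := h ![0, 1, 0]
  have h2 := h ![0, 0, 1]
  have h3 := h ![0, 1, 1]
  have h4 := h ![1, 0, 1]
  have h5 := h ![1, 1, 0]
  simp at h0 h1 h2 h3 h4 h5
  simp [h0, h1, h2] at h3 h4 h5
  ext i
  fin_cases i <;> assumption

theorem triple_smul_eq (a b c v : Fin 3 → ℂ) :
    (a ⬝ᵥ b ⨯₃ c) • v =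
      (b ⨯₃ c ⬝ᵥ v) • a + (c ⨯₃ a ⬝ᵥ v) • b + (a ⨯₃ b ⬝ᵥ v) • c := by
  ext i
  fin_cases i <;>
  · simp [cross_apply, dotProduct, Fin.sum_univ_three]
    ring

/-- A conic through `a`, `b`, `c` in the coordinates given by these three points. -/
theorem triple_sq_mul_conic (q : Fin 6 → ℂ) {a b c : Fin 3 → ℂ} (ha : q ⬝ᵥ veronese a = 0)
    (hb : q ⬝ᵥ veronese b = 0) (hc : q ⬝ᵥ veronese c = 0) (v : Fin 3 → ℂ) :
    (a ⬝ᵥ b ⨯₃ c) ^ 2 * (q ⬝ᵥ veronese v) =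
      (c ⨯₃ a ⬝ᵥ v) * (a ⨯₃ b ⬝ᵥ v) * conicPolar q b c +
      (b ⨯₃ c ⬝ᵥ v) * (a ⨯₃ b ⬝ᵥ v) * conicPolar q c a +
      (b ⨯₃ c ⬝ᵥ v) * (c ⨯₃ a ⬝ᵥ v) * conicPolar q a b := by
  rw [← dotProduct_veronese_smul, triple_smul_eq, dotProduct_veronese_combination, ha, hb, hc]
  ring

/-- A conic through seven of the nine points does not contain the line through two of them. -/
theorem NinePoints.conicPolar_ne_zero {F G : MvPolynomial (Fin 3) ℂ} {p : Fin 9 → Fin 3 → ℂ}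
    (hp : NinePoints F G p) (hF : F.IsHomogeneous 3) (hG : G.IsHomogeneous 3)
    {s : Finset (Fin 9)} (hs : 7 ≤ s.card) {q : Fin 6 → ℂ} (hq0 : q ≠ 0)
    (hq : ∀ i ∈ s, q ⬝ᵥ veronese (p i) = 0) {i j k : Fin 9} (hi : i ∈ s) (hj : j ∈ s)
    (hk : k ∈ s) (hd : p i ⬝ᵥ p j ⨯₃ p k ≠ 0) : conicPolar q (p j) (p k) ≠ 0 := by
  intro hpol
  have hform := triple_sq_mul_conic q (hq i hi) (hq j hj) (hq k hk)
  set a := p i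
  set b := p j
  set c := p k
  set m := conicPolar q c a • (a ⨯₃ b) + conicPolar q a b • (c ⨯₃ a) with hm
  have hfac : ∀ v, (a ⬝ᵥ b ⨯₃ c) ^ 2 * (q ⬝ᵥ veronese v) = (b ⨯₃ c ⬝ᵥ v) * (m ⬝ᵥ v) := by
    intro v
    rw [hform, hpol, hm, add_dotProduct, smul_dotProduct, smul_dotProduct, smul_eq_mul,
      smul_eq_mul]
    ring
  have hcover : s ⊆ s.filter (fun n => b ⨯₃ c ⬝ᵥ p n = 0) ∪ s.filter (fun n => m ⬝ᵥ p n = 0) := by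
    intro n hn
    have := hfac (p n)
    rw [hq n hn, mul_zero, eq_comm, mul_eq_zero] at this
    simpa [hn] using this
  have hcard := (Finset.card_le_card hcover).trans (Finset.card_union_le _ _)
  have hbc : b ⨯₃ c ≠ 0 := fun h => hd (by rw [h, dotProduct_zero])
  have hm0 : m = 0 := by
    by_cases h4 : 4 ≤ (s.filter (fun n => b ⨯₃ c ⬝ᵥ p n = 0)).card
    · exact absurd (hp.line_eq_zero hF hG _ h4 _ fun n hn => (Finset.mem_filter.1 hn).2) hbc
    · exact hp.line_eq_zero hF hG (s.filter fun n => m ⬝ᵥ p n = 0) (by omega) m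
        fun n hn => (Finset.mem_filter.1 hn).2
  refine hq0 (eq_zero_of_forall_dotProduct_veronese q fun v => ?_)
  have := hfac v
  rw [hm0, zero_dotProduct, mul_zero] at this
  exact (mul_eq_zero.1 this).resolve_left (pow_ne_zero 2 hd)

/-- No seven of the nine points lie on a conic. -/
theorem NinePoints.conic_eq_zero {F G : MvPolynomial (Fin 3) ℂ} {p : Fin 9 → Fin 3 → ℂ}
    (hp : NinePoints F G p) (hF : F.IsHomogeneous 3) (hG : G.IsHomogeneous 3)
    (s : Finset (Fin 9)) (hs : 7 ≤ s.card) (q : Fin 6 → ℂ)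
    (hq : ∀ i ∈ s, q ⬝ᵥ veronese (p i) = 0) : q = 0 := by
  by_contra hq0
  obtain ⟨i, hi, j, hj, hij⟩ := Finset.one_lt_card.1 (by omega : 1 < s.card)
  obtain ⟨k, hk, hd'⟩ : ∃ k ∈ s, p i ⨯₃ p j ⬝ᵥ p k ≠ 0 := by
    by_contra! h
    exact hp.cross_ne_zero hij (hp.line_eq_zero hF hG s (by omega) _ h)
  have hd : p i ⬝ᵥ p j ⨯₃ p k ≠ 0 := by
    rwa [triple_product_permutation, triple_product_permutation, dotProduct_comm]
  have hα := hp.conicPolar_ne_zero hF hG hs hq0 hq hi hj hk hd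
  have hβ := hp.conicPolar_ne_zero hF hG hs hq0 hq hj hk hi
    (by rwa [← triple_product_permutation])
  have hγ := hp.conicPolar_ne_zero hF hG hs hq0 hq hk hi hj
    (by rwa [triple_product_permutation])
  have hform := triple_sq_mul_conic q (hq i hi) (hq j hj) (hq k hk)
  have hcramer := triple_smul_eq (p i) (p j) (p k)
  set d := p i ⬝ᵥ p j ⨯₃ p k with hddef
  set α := conicPolar q (p j) (p k)
  set β := conicPolar q (p k) (p i)
  set γ := conicPolar q (p i) (p j)
  obtain ⟨f, hfdef⟩ : ∃ f : Fin 3 → Polynomial ℂ, f = fun n =>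
      Polynomial.C (-α * p i n) * Polynomial.X ^ 2 +
      Polynomial.C (-α * p i n - β * p j n + γ * p k n) * Polynomial.X +
      Polynomial.C (-β * p j n) := ⟨_, rfl⟩
  have hev : ∀ t, (fun n => (f n).eval t) =
      (-α * (t * (1 + t))) • p i + (-β * (1 + t)) • p j + (γ * t) • p k := by
    intro t; ext n; simp [hfdef]; ring
  have hB : ∀ t, p k ⨯₃ p i ⬝ᵥ (fun n => (f n).eval t) = -β * (1 + t) * d := by
    intro t
    rw [hev, dotProduct_add, dotProduct_add, dotProduct_smul, dotProduct_smul, dotProduct_smul,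
      dotProduct_comm _ (p i), dotProduct_comm _ (p j), dotProduct_comm _ (p k),
      dot_cross_self, dot_self_cross, ← triple_product_permutation]
    simp [hddef]
  have hC : ∀ t, p i ⨯₃ p j ⬝ᵥ (fun n => (f n).eval t) = γ * t * d := by
    intro t
    rw [hev, dotProduct_add, dotProduct_add, dotProduct_smul, dotProduct_smul, dotProduct_smul,
      dotProduct_comm _ (p i), dotProduct_comm _ (p j), dotProduct_comm _ (p k),
      dot_cross_self, dot_self_cross, triple_product_permutation]
    simp [hddef]
  refine hp.not_curve hF hG two_pos f ?_ ?_ ?_ i (-α) ?_ (s.erase i) ?_ ?_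
  · intro n
    rw [hfdef]
    exact Polynomial.natDegree_quadratic_le
  · intro t h0
    have h1 := hB t
    have h2 := hC t
    rw [h0, dotProduct_zero] at h1 h2
    have ht : t = 0 := by simpa [hγ, hd] using h2
    simp [ht, hβ, hd] at h1
  · intro t t' e h
    have h1 := hB t
    have h2 := hC t
    rw [h, dotProduct_smul, hB, smul_eq_mul] at h1
    rw [h, dotProduct_smul, hC, smul_eq_mul] at h2
    have h1' : e * (1 + t') = 1 + t := mul_left_cancel₀ (mul_ne_zero hβ hd)
      (by linear_combination -h1)
    have h2' : e * t' = t := mul_left_cancel₀ (mul_ne_zero hγ hd) (by linear_combination h2)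
    have he : e = 1 := by linear_combination h1' - h2'
    rw [← h2', he, one_mul]
  · ext n
    rw [hfdef, Polynomial.coeff_add, Polynomial.coeff_add, Polynomial.coeff_C_mul_X_pow,
      Polynomial.coeff_C_mul_X, Polynomial.coeff_C]
    simp
  · rw [Finset.card_erase_of_mem hi]
    omega
  · intro n hn
    obtain ⟨hni, hns⟩ := Finset.mem_erase.1 hn
    by_cases hnj : n = j
    · exact ⟨0, -β, neg_ne_zero.2 hβ, by rw [hev, hnj]; module⟩
    by_cases hnk : n = k
    · exact ⟨-1, -γ, neg_ne_zero.2 hγ, by rw [hev, hnk]; module⟩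
    have hrel := hform (p n)
    have hsum := hcramer (p n)
    rw [hq n hns, mul_zero] at hrel
    set x := p j ⨯₃ p k ⬝ᵥ p n
    set y := p k ⨯₃ p i ⬝ᵥ p n
    set z := p i ⨯₃ p j ⬝ᵥ p n
    have hnot : ∀ m, n ≠ m → ∀ e, d • p n ≠ e • p m := fun m hnm e he => hd
      (eq_zero_of_smul_add_smul_eq_zero (hp.cross_ne_zero hnm) d (-e) (by rw [he]; module)).1
    have hx : x ≠ 0 := by
      intro h0
      have : y * z * α = 0 := by rw [hrel, h0]; ring
      rcases mul_eq_zero.1 ((mul_eq_zero.1 this).resolve_right hα) with h1 | h1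
      · exact hnot k hnk z (by rw [hsum, h0, h1]; module)
      · exact hnot j hnj y (by rw [hsum, h0, h1]; module)
    have hy : y ≠ 0 := by
      intro h0
      have : x * z * β = 0 := by rw [hrel, h0]; ring
      rcases mul_eq_zero.1 ((mul_eq_zero.1 this).resolve_right hβ) with h1 | h1
      · exact hx h1
      · exact hnot i hni x (by rw [hsum, h0, h1]; module)
    have hz : z ≠ 0 := by
      intro h0
      have : x * y * γ = 0 := by rw [hrel, h0]; ring
      rcases mul_eq_zero.1 ((mul_eq_zero.1 this).resolve_right hγ) with h1 | h1
      · exact hx h1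
      · exact hy h1
    refine ⟨β * x / (α * y), β * γ * x / (α * y * z) * d, ?_, ?_⟩
    · simp [hα, hβ, hγ, hx, hy, hz, hd]
    · rw [hev, mul_smul _ d, hsum, smul_add, smul_add, smul_smul, smul_smul, smul_smul]
      congr 1
      · congr 2
        · field_simp
          linear_combination hrel
        · field_simp
          linear_combination hrel
      · congr 1
        field_simp

/-- The linear form with coefficients `l`. -/
noncomputable def linePolynomial (l : Fin 3 → ℂ) : MvPolynomial (Fin 3) ℂ :=
  ∑ i, C (l i) * X i

/-- The quadratic form with coefficients `c`. -/
noncomputable def conicPolynomial (c : Fin 6 → ℂ) : MvPolynomial (Fin 3) ℂ :=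
  C (c 0) * X 0 ^ 2 + C (c 1) * X 1 ^ 2 + C (c 2) * X 2 ^ 2 + C (c 3) * (X 1 * X 2) +
    C (c 4) * (X 0 * X 2) + C (c 5) * (X 0 * X 1)

theorem isHomogeneous_linePolynomial (l : Fin 3 → ℂ) : (linePolynomial l).IsHomogeneous 1 :=
  IsHomogeneous.sum _ _ _ fun _ _ => isHomogeneous_C_mul_X _ _

theorem isHomogeneous_conicPolynomial (c : Fin 6 → ℂ) : (conicPolynomial c).IsHomogeneous 2 := by
  have hsq (d : ℂ) (i : Fin 3) : (C d * X i ^ 2 : MvPolynomial (Fin 3) ℂ).IsHomogeneous 2 :=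
    IsHomogeneous.C_mul (isHomogeneous_X_pow i 2) d
  have hmul (d : ℂ) (i j : Fin 3) : (C d * (X i * X j) : MvPolynomial (Fin 3) ℂ).IsHomogeneous 2 :=
    IsHomogeneous.C_mul ((isHomogeneous_X ℂ i).mul (isHomogeneous_X ℂ j)) d
  exact (((((hsq _ _).add (hsq _ _)).add (hsq _ _)).add (hmul _ _ _)).add (hmul _ _ _)).add
    (hmul _ _ _)

theorem eval_linePolynomial (l v : Fin 3 → ℂ) : eval v (linePolynomial l) = l ⬝ᵥ v := by
  simp [linePolynomial, dotProduct]

theorem eval_conicPolynomial (c : Fin 6 → ℂ) (v : Fin 3 → ℂ) :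
    eval v (conicPolynomial c) = c ⬝ᵥ veronese v := by
  simp [conicPolynomial, dotProduct_veronese]

theorem exists_conic_through_five (q : Fin 5 → Fin 3 → ℂ) :
    ∃ c : Fin 6 → ℂ, c ≠ 0 ∧ ∀ m, c ⬝ᵥ veronese (q m) = 0 := by
  let E : (Fin 6 → ℂ) →ₗ[ℂ] (Fin 5 → ℂ) := (Matrix.of fun m => veronese (q m)).mulVecLin
  obtain ⟨c, hc, hc0⟩ := (Submodule.ne_bot_iff _).1
    (LinearMap.ker_ne_bot_of_finrank_lt (f := E) (by simp))
  refine ⟨c, hc0, fun m => ?_⟩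
  rw [dotProduct_comm]
  exact congrFun (LinearMap.mem_ker.1 hc) m

/-- If five points impose independent conditions on conics, the conic through them is unique. -/
theorem conic_through_five_unique {q : Fin 5 → Fin 3 → ℂ}
    (hq : ∀ m, ∃ c : Fin 6 → ℂ, c ⬝ᵥ veronese (q m) ≠ 0 ∧ ∀ n ≠ m, c ⬝ᵥ veronese (q n) = 0)
    {c d : Fin 6 → ℂ} (hc0 : c ≠ 0) (hc : ∀ m, c ⬝ᵥ veronese (q m) = 0)
    (hd : ∀ m, d ⬝ᵥ veronese (q m) = 0) : ∃ z : ℂ, z • c = d := by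
  let E : (Fin 6 → ℂ) →ₗ[ℂ] (Fin 5 → ℂ) := (Matrix.of fun m => veronese (q m)).mulVecLin
  have hE (c : Fin 6 → ℂ) (m : Fin 5) : E c m = c ⬝ᵥ veronese (q m) :=
    dotProduct_comm (veronese (q m)) c
  have hsurj : LinearMap.range E = ⊤ := by
    rw [LinearMap.range_eq_top]
    intro y
    choose b hb hb' using hq
    refine ⟨∑ m, (y m / (b m ⬝ᵥ veronese (q m))) • b m, funext fun n => ?_⟩
    rw [map_sum, Finset.sum_apply, Finset.sum_eq_single n]
    · rw [map_smul, Pi.smul_apply, hE, smul_eq_mul, div_mul_cancel₀ _ (hb n)]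
    · intro m _ hmn
      rw [map_smul, Pi.smul_apply, hE, hb' m n hmn.symm, smul_zero]
    · simp
  have hker : Module.finrank ℂ (LinearMap.ker E) = 1 := by
    have h := E.finrank_range_add_finrank_ker
    rw [hsurj, finrank_top, Module.finrank_fin_fun, Module.finrank_fin_fun] at h
    omega
  have hmem {c : Fin 6 → ℂ} (hc : ∀ m, c ⬝ᵥ veronese (q m) = 0) : c ∈ LinearMap.ker E := by
    rw [LinearMap.mem_ker]
    ext m
    rw [hE, hc, Pi.zero_apply]
  have hne : (⟨c, hmem hc⟩ : LinearMap.ker E) ≠ 0 := mt (Submodule.mk_eq_zero _ _).1 hc0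
  obtain ⟨z, hz⟩ := exists_smul_eq_of_finrank_eq_one hker hne ⟨d, hmem hd⟩
  exact ⟨z, congrArg Subtype.val hz⟩

section NinePoints

variable {F G : MvPolynomial (Fin 3) ℂ} {p : Fin 9 → Fin 3 → ℂ}

/-- No four of the nine points are collinear. -/
theorem NinePoints.triple_ne_zero (hp : NinePoints F G p) (hF : F.IsHomogeneous 3)
    (hG : G.IsHomogeneous 3) {i j k l : Fin 9} (hij : i ≠ j) (hik : i ≠ k) (hil : i ≠ l)
    (hjk : j ≠ k) (hjl : j ≠ l) (hkl : k ≠ l) (h : p i ⬝ᵥ p j ⨯₃ p k = 0) :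
    p i ⬝ᵥ p j ⨯₃ p l ≠ 0 := by
  intro h'
  refine hp.cross_ne_zero hij (hp.line_eq_zero hF hG {i, j, k, l} ?_ _ ?_)
  · rw [Finset.card_insert_of_notMem, Finset.card_insert_of_notMem, Finset.card_pair hkl] <;>
      simp [*]
  · simp only [Finset.mem_insert, Finset.mem_singleton]
    rintro m (rfl | rfl | rfl | rfl)
    · rw [dotProduct_comm, dot_self_cross]
    · rw [dotProduct_comm, dot_cross_self]
    · rw [dotProduct_comm, triple_product_permutation, h]
    · rw [dotProduct_comm, triple_product_permutation, h']

/-- A conic through four of the nine points and avoiding a fifth one. -/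
theorem NinePoints.exists_conic_avoiding (hp : NinePoints F G p) (hF : F.IsHomogeneous 3)
    (hG : G.IsHomogeneous 3) {x a b c d : Fin 9} (hxa : x ≠ a) (hxb : x ≠ b) (hxc : x ≠ c)
    (hxd : x ≠ d) (hab : a ≠ b) (hac : a ≠ c) (had : a ≠ d) (hbc : b ≠ c) (hbd : b ≠ d)
    (hcd : c ≠ d) :
    ∃ q : Fin 6 → ℂ, q ⬝ᵥ veronese (p x) ≠ 0 ∧ q ⬝ᵥ veronese (p a) = 0 ∧
      q ⬝ᵥ veronese (p b) = 0 ∧ q ⬝ᵥ veronese (p c) = 0 ∧ q ⬝ᵥ veronese (p d) = 0 := by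
  have hswap (u v : Fin 3 → ℂ) : p x ⬝ᵥ u ⨯₃ v = -(p x ⬝ᵥ v ⨯₃ u) := by
    rw [← cross_anticomm, dotProduct_neg]
  have hl (u v : Fin 9) : p u ⨯₃ p v ⬝ᵥ p u = 0 := by rw [dotProduct_comm, dot_self_cross]
  have hr (u v : Fin 9) : p u ⨯₃ p v ⬝ᵥ p v = 0 := by rw [dotProduct_comm, dot_cross_self]
  by_cases h : p x ⬝ᵥ p a ⨯₃ p b = 0 ∨ p x ⬝ᵥ p c ⨯₃ p d = 0
  · refine ⟨lineProduct (p a ⨯₃ p c) (p b ⨯₃ p d), ?_, ?_, ?_, ?_, ?_⟩ <;>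
      simp only [lineProduct_dotProduct_veronese, hl, hr, zero_mul, mul_zero]
    rw [dotProduct_comm, dotProduct_comm _ (p x)]
    rcases h with h | h
    · refine mul_ne_zero (hp.triple_ne_zero hF hG hxa hxb hxc hab hac hbc h)
        (hp.triple_ne_zero hF hG hxb hxa hxd hab.symm hbd had ?_)
      rw [hswap, h, neg_zero]
    · rw [hswap, hswap (p b)]
      refine mul_ne_zero (neg_ne_zero.2
        (hp.triple_ne_zero hF hG hxc hxd hxa hcd hac.symm had.symm h))
        (neg_ne_zero.2 (hp.triple_ne_zero hF hG hxd hxc hxb hcd.symm hbd.symm hbc.symm ?_))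
      rw [hswap, h, neg_zero]
  · rw [not_or] at h
    refine ⟨lineProduct (p a ⨯₃ p b) (p c ⨯₃ p d), ?_, ?_, ?_, ?_, ?_⟩ <;>
      simp only [lineProduct_dotProduct_veronese, hl, hr, zero_mul, mul_zero]
    rw [dotProduct_comm, dotProduct_comm _ (p x)]
    exact mul_ne_zero h.1 h.2

theorem NinePoints.exists_dual_conics (hp : NinePoints F G p) (hF : F.IsHomogeneous 3)
    (hG : G.IsHomogeneous 3) {e : Fin 5 → Fin 9} (he : e.Injective) (m : Fin 5) :
    ∃ c : Fin 6 → ℂ, c ⬝ᵥ veronese (p (e m)) ≠ 0 ∧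
      ∀ n ≠ m, c ⬝ᵥ veronese (p (e n)) = 0 := by
  obtain ⟨c, h0, h1, h2, h3, h4⟩ := hp.exists_conic_avoiding hF hG
    (x := e m) (a := e (m + 1)) (b := e (m + 2)) (c := e (m + 3)) (d := e (m + 4))
    (he.ne (by lia)) (he.ne (by lia)) (he.ne (by lia)) (he.ne (by lia)) (he.ne (by lia))
    (he.ne (by lia)) (he.ne (by lia)) (he.ne (by lia)) (he.ne (by lia)) (he.ne (by lia))
  refine ⟨c, h0, fun n hn => ?_⟩
  obtain rfl | rfl | rfl | rfl : n = m + 1 ∨ n = m + 2 ∨ n = m + 3 ∨ n = m + 4 := by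
    clear h0 h1 h2 h3 h4
    decide +revert
  all_goals assumption

/-- The union of a line and a conic avoiding `x` is a cubic avoiding `x`. -/
theorem exists_cubic_of_line_conic {l : Fin 3 → ℂ} {c : Fin 6 → ℂ} {x : Fin 3 → ℂ}
    {ι : Type*} {q : ι → Fin 3 → ℂ} (hl : l ⬝ᵥ x ≠ 0) (hc : c ⬝ᵥ veronese x ≠ 0)
    (h : ∀ m, l ⬝ᵥ q m = 0 ∨ c ⬝ᵥ veronese (q m) = 0) :
    ∃ K : MvPolynomial (Fin 3) ℂ, K.IsHomogeneous 3 ∧ eval x K ≠ 0 ∧ ∀ m, eval (q m) K = 0 := by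
  refine ⟨linePolynomial l * conicPolynomial c,
    (isHomogeneous_linePolynomial l).mul (isHomogeneous_conicPolynomial c), ?_, fun m => ?_⟩
  · rw [map_mul, eval_linePolynomial, eval_conicPolynomial]
    exact mul_ne_zero hl hc
  · rw [map_mul, eval_linePolynomial, eval_conicPolynomial]
    exact mul_eq_zero.2 (h m)

theorem NinePoints.exists_cubic_of_triple_ne_zero (hp : NinePoints F G p)
    (hF : F.IsHomogeneous 3) (hG : G.IsHomogeneous 3) {e : Fin 8 → Fin 9} (he : e.Injective)
    (h2 : p (e 0) ⬝ᵥ p (e 1) ⨯₃ p (e 2) ≠ 0) (h3 : p (e 0) ⬝ᵥ p (e 1) ⨯₃ p (e 3) ≠ 0) :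
    ∃ K : MvPolynomial (Fin 3) ℂ, K.IsHomogeneous 3 ∧ eval (p (e 0)) K ≠ 0 ∧
      ∀ m, m ≠ 0 → eval (p (e m)) K = 0 := by
  by_contra hK
  have hpair {i : Fin 8} (hi : p (e 0) ⬝ᵥ p (e 1) ⨯₃ p (e i) ≠ 0) {c : Fin 6 → ℂ}
      (hc : ∀ m, m ≠ 0 → m ≠ 1 → m ≠ i → c ⬝ᵥ veronese (p (e m)) = 0) :
      c ⬝ᵥ veronese (p (e 0)) = 0 := by
    by_contra h0
    rw [dotProduct_comm] at hi
    obtain ⟨K, h, h', hm⟩ := exists_cubic_of_line_conic (q := fun m : {m : Fin 8 // m ≠ 0} =>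
      p (e m)) hi h0 fun m => by
        by_cases h1 : m.1 = 1
        · exact Or.inl (by rw [h1, dotProduct_comm, dot_self_cross])
        by_cases h2 : m.1 = i
        · exact Or.inl (by rw [h2, dotProduct_comm, dot_cross_self])
        exact Or.inr (hc _ m.2 h1 h2)
    exact hK ⟨K, h, h', fun m hm' => hm ⟨m, hm'⟩⟩
  obtain ⟨c, hc0, hc⟩ := exists_conic_through_five fun m => p (e (![3, 4, 5, 6, 7] m))
  obtain ⟨d, hd0, hd⟩ := exists_conic_through_five fun m => p (e (![2, 4, 5, 6, 7] m))
  simp only [Fin.forall_fin_succ, Matrix.cons_val_zero, Matrix.cons_val_succ,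
    IsEmpty.forall_iff, and_true] at hc hd
  obtain ⟨c3, c4, c5, c6, c7⟩ := hc
  obtain ⟨d2, d4, d5, d6, d7⟩ := hd
  have c0 := hpair h2 (c := c) (by
    intro m
    fin_cases m <;> simp [*])
  have d0 := hpair h3 (c := d) (by
    intro m
    fin_cases m <;> simp [*])
  have hinj : Function.Injective fun m : Fin 5 => e (![0, 4, 5, 6, 7] m) :=
    he.comp (by decide)
  obtain ⟨z, hz⟩ := conic_through_five_unique (hp.exists_dual_conics hF hG hinj) hd0
    (by simp [Fin.forall_fin_succ, *]) (d := c) (by simp [Fin.forall_fin_succ, *])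
  have c2 : c ⬝ᵥ veronese (p (e 2)) = 0 := by rw [← hz, smul_dotProduct, d2, smul_zero]
  refine hc0 (hp.conic_eq_zero hF hG ((Finset.univ.erase 1).image e) ?_ c ?_)
  · rw [Finset.card_image_of_injective _ he]
    decide
  · simp only [Finset.mem_image, Finset.mem_erase]
    rintro _ ⟨m, hm, rfl⟩
    revert hm
    fin_cases m <;> simp [*]

/-- Any eight of the nine points impose independent conditions on cubics. -/
theorem NinePoints.exists_cubic_avoiding (hp : NinePoints F G p) (hF : F.IsHomogeneous 3)
    (hG : G.IsHomogeneous 3) {i j : Fin 9} (hij : i ≠ j) :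
    ∃ K : MvPolynomial (Fin 3) ℂ, K.IsHomogeneous 3 ∧ eval (p j) K ≠ 0 ∧
      ∀ l, l ≠ i → l ≠ j → eval (p l) K = 0 := by
  obtain ⟨σ, h0, h8⟩ : ∃ σ : Equiv.Perm (Fin 9), σ 0 = j ∧ σ 8 = i := by
    refine ⟨Equiv.swap 0 j * Equiv.swap 8 (Equiv.swap 0 j i), ?_, by simp⟩
    have h : (0 : Fin 9) ≠ Equiv.swap 0 j i := by
      intro h
      rw [eq_comm, Equiv.swap_apply_eq_iff, Equiv.swap_apply_left] at h
      exact hij h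
    rw [Equiv.Perm.mul_apply, Equiv.swap_apply_of_ne_of_ne (by decide) h, Equiv.swap_apply_left]
  suffices h : ∃ τ : Equiv.Perm (Fin 8), τ 0 = 0 ∧
      p (σ (τ 0).castSucc) ⬝ᵥ p (σ (τ 1).castSucc) ⨯₃ p (σ (τ 2).castSucc) ≠ 0 ∧
      p (σ (τ 0).castSucc) ⬝ᵥ p (σ (τ 1).castSucc) ⨯₃ p (σ (τ 3).castSucc) ≠ 0 by
    obtain ⟨τ, hτ, h2, h3⟩ := h
    obtain ⟨K, hK, hK0, hK'⟩ := hp.exists_cubic_of_triple_ne_zero hF hG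
      (e := fun m => σ (τ m).castSucc)
      (σ.injective.comp ((Fin.castSucc_injective 8).comp τ.injective)) h2 h3
    rw [hτ, Fin.castSucc_zero, h0] at hK0
    refine ⟨K, hK, hK0, fun l hli hlj => ?_⟩
    obtain ⟨m, rfl⟩ := σ.surjective l
    have hm : m ≠ Fin.last 8 := fun h => hli (h ▸ h8)
    obtain ⟨n, rfl⟩ := Fin.exists_castSucc_eq.2 hm
    obtain ⟨r, rfl⟩ := τ.surjective n
    refine hK' r ?_
    rintro rfl
    rw [hτ] at hlj
    exact hlj h0
  have key {a b : Fin 9} (ha : a ≠ 0) (ha1 : a ≠ 1) (hb : b ≠ 0) (hb1 : b ≠ 1) (hab : a ≠ b)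
      (h : p (σ 0) ⬝ᵥ p (σ 1) ⨯₃ p (σ a) = 0) : p (σ 0) ⬝ᵥ p (σ 1) ⨯₃ p (σ b) ≠ 0 :=
    hp.triple_ne_zero hF hG (σ.injective.ne (by decide)) (σ.injective.ne ha.symm)
      (σ.injective.ne hb.symm) (σ.injective.ne ha1.symm) (σ.injective.ne hb1.symm)
      (σ.injective.ne hab) h
  by_cases h2 : p (σ 0) ⬝ᵥ p (σ 1) ⨯₃ p (σ 2) = 0
  · exact ⟨Equiv.swap 2 4, by decide,
      key (b := 4) (by decide) (by decide) (by decide) (by decide) (by decide) h2,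
      key (b := 3) (by decide) (by decide) (by decide) (by decide) (by decide) h2⟩
  by_cases h3 : p (σ 0) ⬝ᵥ p (σ 1) ⨯₃ p (σ 3) = 0
  · exact ⟨Equiv.swap 3 4, by decide, h2,
      key (b := 4) (by decide) (by decide) (by decide) (by decide) (by decide) h3⟩
  exact ⟨Equiv.refl _, rfl, h2, h3⟩

end NinePoints

/-- The cubics vanishing at the points `p i` with `i ≥ k`. -/
noncomputable def cubicsThrough (p : Fin 9 → Fin 3 → ℂ) (k : ℕ) :
    Submodule ℂ (MvPolynomial (Fin 3) ℂ) :=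
  homogeneousSubmodule (Fin 3) ℂ 3 ⊓
    ⨅ i : {i : Fin 9 // k ≤ i}, LinearMap.ker (aeval (p i)).toLinearMap

theorem mem_cubicsThrough {p : Fin 9 → Fin 3 → ℂ} {k : ℕ} {K : MvPolynomial (Fin 3) ℂ} :
    K ∈ cubicsThrough p k ↔
      K.IsHomogeneous 3 ∧ ∀ i : Fin 9, k ≤ (i : ℕ) → eval (p i) K = 0 := by
  simp [cubicsThrough, Submodule.mem_iInf]

theorem grad_add (H K : MvPolynomial (Fin 3) ℂ) (v : Fin 3 → ℂ) :
    grad (H + K) v = grad H v + grad K v := by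
  ext i
  simp [grad]

theorem grad_smul (t : ℂ) (K : MvPolynomial (Fin 3) ℂ) (v : Fin 3 → ℂ) :
    grad (t • K) v = t • grad K v := by
  ext i
  simp [grad]

theorem continuous_grad (K : MvPolynomial (Fin 3) ℂ) : Continuous (grad K) :=
  continuous_pi fun _ => MvPolynomial.continuous_eval _

theorem transverse_iff {H K : MvPolynomial (Fin 3) ℂ} {v : Fin 3 → ℂ} :
    Transverse H K v ↔ grad H v ⨯₃ grad K v ≠ 0 :=
  crossProduct_ne_zero_iff_linearIndependent.symm

theorem grad_smul_point {K : MvPolynomial (Fin 3) ℂ} (hK : K.IsHomogeneous 3) (c : ℂ)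
    (v : Fin 3 → ℂ) : grad K (c • v) = c ^ 2 • grad K v := by
  ext i
  exact eval_smul_of_isHomogeneous hK.pderiv c v

/-- The linear map `K ↦ ∇K(v) × w`. -/
noncomputable def gradCross (v w : Fin 3 → ℂ) :
    MvPolynomial (Fin 3) ℂ →ₗ[ℂ] Fin 3 → ℂ where
  toFun K := grad K v ⨯₃ w
  map_add' H K := by rw [grad_add, map_add, LinearMap.add_apply]
  map_smul' t K := by rw [grad_smul, map_smul, LinearMap.smul_apply, RingHom.id_apply]

open Filter Topology

/-- Smoothness is an open condition in a pencil of cubics. -/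
theorem SmoothCubic.eventually_add_smul {F K : MvPolynomial (Fin 3) ℂ} (hF : SmoothCubic F)
    (hK : K.IsHomogeneous 3) : ∀ᶠ t : ℂ in 𝓝 0, SmoothCubic (F + t • K) := by
  have hsphere : ∀ᶠ t : ℂ in 𝓝 0, ∀ v ∈ Metric.sphere (0 : Fin 3 → ℂ) 1,
      grad F v + t • grad K v ≠ 0 := by
    refine (isCompact_sphere 0 1).eventually_forall_of_forall_eventually fun v hv => ?_
    have hcont : Continuous fun z : ℂ × (Fin 3 → ℂ) => grad F z.2 + z.1 • grad K z.2 :=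
      ((continuous_grad F).comp continuous_snd).add
        (continuous_fst.smul ((continuous_grad K).comp continuous_snd))
    refine hcont.continuousAt.eventually_ne ?_
    rw [zero_smul, add_zero]
    intro h
    rw [hF.2 v h] at hv
    simp at hv
  filter_upwards [hsphere] with t ht
  have hhom : (F + t • K).IsHomogeneous 3 :=
    hF.1.2.add ((homogeneousSubmodule (Fin 3) ℂ 3).smul_mem t hK)
  have hgrad (v : Fin 3 → ℂ) (hv : grad (F + t • K) v = 0) : v = 0 := by
    by_contra h
    have hn : (‖v‖ : ℂ) ≠ 0 := by simpa using h
    refine ht ((‖v‖ : ℂ)⁻¹ • v) ?_ ?_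
    · simp [norm_smul, h]
    · rw [← grad_smul, ← grad_add, grad_smul_point hhom, hv, smul_zero]
  refine ⟨⟨fun h => ?_, hhom⟩, hgrad⟩
  have h1 := hgrad (fun _ => 1) (by rw [h]; ext i; simp [grad])
  simpa using congrFun h1 0

/-- A general cubic through the last points avoids the first ones and is transversal to `F`. -/
theorem NinePoints.exists_direction {F G : MvPolynomial (Fin 3) ℂ} {p : Fin 9 → Fin 3 → ℂ}
    (hp : NinePoints F G p) (hF : F.IsHomogeneous 3) (hG : G.IsHomogeneous 3)
    (htrans : ∀ i, Transverse F G (p i)) {k : ℕ} (hk : 2 ≤ k) :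
    ∃ K : MvPolynomial (Fin 3) ℂ, K.IsHomogeneous 3 ∧
      (∀ i : Fin 9, k ≤ (i : ℕ) → eval (p i) K = 0) ∧
      (∀ i : Fin 9, (i : ℕ) < k → eval (p i) K ≠ 0) ∧
      (∀ i : Fin 9, k ≤ (i : ℕ) → grad K (p i) ⨯₃ grad F (p i) ≠ 0) := by
  let V := cubicsThrough p k
  let B (i : Fin 9) : Submodule ℂ V :=
    if (i : ℕ) < k then LinearMap.ker ((aeval (R := ℂ) (p i)).toLinearMap ∘ₗ V.subtype)
    else LinearMap.ker (gradCross (p i) (grad F (p i)) ∘ₗ V.subtype)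
  have hB (i : Fin 9) : B i ≠ ⊤ := by
    intro htop
    have hall (K : V) : K ∈ B i := htop ▸ Submodule.mem_top
    by_cases hi : (i : ℕ) < k
    · obtain ⟨j, hji, hj⟩ : ∃ j : Fin 9, j ≠ i ∧ (j : ℕ) < k := by
        by_cases h0 : i = 0
        · exact ⟨1, by rw [h0]; decide, by simp; omega⟩
        · exact ⟨0, Ne.symm h0, by simp; omega⟩
      obtain ⟨K, hK, hK0, hK'⟩ := hp.exists_cubic_avoiding hF hG hji
      have hKV : K ∈ V := mem_cubicsThrough.2 ⟨hK, fun l hl => hK' l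
        (by rintro rfl; omega) (by rintro rfl; omega)⟩
      have := hall ⟨K, hKV⟩
      simp only [B, if_pos hi, LinearMap.mem_ker] at this
      exact hK0 (by simpa [coe_aeval_eq_eval] using this)
    · have hGV : G ∈ V := mem_cubicsThrough.2 ⟨hG, fun l _ => (hp.2.2.1 l).2⟩
      have := hall ⟨G, hGV⟩
      simp only [B, if_neg hi, LinearMap.mem_ker] at this
      refine transverse_iff.1 (htrans i) ?_
      rw [← cross_anticomm, neg_eq_zero]
      exact this
  obtain ⟨K, hK⟩ : ∃ K : V, ∀ i, K ∉ B i := by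
    by_contra! h
    obtain ⟨i, hi⟩ := Subspace.exists_eq_top_of_iUnion_eq_univ (p := B)
      (Set.eq_univ_of_forall fun K => Set.mem_iUnion.2 (h K))
    exact hB i hi
  obtain ⟨hKhom, hKzero⟩ := mem_cubicsThrough.1 K.2
  refine ⟨K, hKhom, hKzero, fun i hi h => hK i ?_, fun i hi h => hK i ?_⟩
  · simp only [B, if_pos hi, LinearMap.mem_ker]
    simpa [coe_aeval_eq_eval] using h
  · simp only [B, if_neg hi.not_gt, LinearMap.mem_ker]
    exact h

/-- For every `2 ≤ k ≤ 9` there is a smooth cubic `H` vanishing at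
`p_{k+1}, …, p₉` (the points `p i` with `k ≤ i`), not vanishing at any of
`p₁, …, p_k` (the points `p i` with `i < k`), and meeting both `F` and `G`
transversally at each of the points through which it passes. -/
theorem exists_smooth_cubic_through_last_points_transversal
    (F G : MvPolynomial (Fin 3) ℂ) (hF : SmoothCubic F) (hG : SmoothCubic G)
    (p : Fin 9 → Fin 3 → ℂ) (hp : NinePoints F G p)
    (htrans : ∀ i, Transverse F G (p i)) :
    ∀ k : ℕ, 2 ≤ k → k ≤ 9 →
      ∃ H : MvPolynomial (Fin 3) ℂ, SmoothCubic H ∧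
        (∀ i : Fin 9, k ≤ (i : ℕ) → eval (p i) H = 0) ∧
        (∀ i : Fin 9, (i : ℕ) < k → eval (p i) H ≠ 0) ∧
        (∀ i : Fin 9, k ≤ (i : ℕ) → Transverse H F (p i) ∧ Transverse H G (p i)) := by
  intro k hk _
  obtain ⟨K, hK, hKzero, hKne, hKcross⟩ := hp.exists_direction hF.1.2 hG.1.2 htrans hk
  have hGtrans : ∀ᶠ t : ℂ in 𝓝 0, ∀ i,
      grad F (p i) ⨯₃ grad G (p i) + t • (grad K (p i) ⨯₃ grad G (p i)) ≠ 0 := by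
    refine eventually_all.2 fun i => ?_
    have hcont : Continuous fun t : ℂ =>
        grad F (p i) ⨯₃ grad G (p i) + t • (grad K (p i) ⨯₃ grad G (p i)) :=
      continuous_const.add (continuous_id.smul continuous_const)
    refine hcont.continuousAt.eventually_ne ?_
    rw [zero_smul, add_zero]
    exact transverse_iff.1 (htrans i)
  obtain ⟨t, ⟨hsmooth, hGt⟩, ht⟩ := (((hF.eventually_add_smul hK).and hGtrans).filter_mono
    nhdsWithin_le_nhds |>.and (eventually_mem_nhdsWithin (a := (0 : ℂ)) (s := {0}ᶜ))).exists
  have heval (i : Fin 9) : eval (p i) (F + t • K) = t * eval (p i) K := by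
    rw [map_add, (hp.2.2.1 i).1, zero_add, smul_eval]
  refine ⟨F + t • K, hsmooth, fun i hi => ?_, fun i hi => ?_, fun i hi => ⟨?_, ?_⟩⟩
  · rw [heval, hKzero i hi, mul_zero]
  · rw [heval]
    exact mul_ne_zero ht (hKne i hi)
  · rw [transverse_iff, grad_add, grad_smul, map_add, LinearMap.add_apply, cross_self, zero_add,
      map_smul, LinearMap.smul_apply]
    exact smul_ne_zero ht (hKcross i hi)
  · rw [transverse_iff, grad_add, grad_smul, map_add, LinearMap.add_apply, map_smul,
      LinearMap.smul_apply]
    exact hGt i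
end
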